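/- Let T be a triangulated category and X a cosuspended subcategory of T with X = add(X). Then the following are equivalent: (a) there is a bounded co-t-structure (X, Y) on T; (b) Δ̄_T(X ∩ X^⊥[-1]) = T; (c) there is a class ω = add(ω) with ω ⊆ X, ω X-injective, and Δ̄_T(ω) = T; (d) there is a silting class ω = add(ω) with Δ̄_T(ω) = T and ω ⊆ X ⊆ ω^∨. Moreover, if one of these conditions holds, then X = _ωU = ω^∨, Y = U_ω, and ω = X ∩ Y = X ∩ X^⊥[-1]. -/

import Mathlib

open CategoryTheory CategoryTheory.Limits CategoryTheory.Pretriangulated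

universe v u

variable (C : Type u) [Category.{v} C] [HasZeroObject C] [HasShift C ℤ]
  [Preadditive C] [∀ n : ℤ, (CategoryTheory.shiftFunctor C n).Additive]
  [Pretriangulated C]

namespace CotPaper

variable {C}

/-- The shift `X⟦n⟧` of a class of objects `X` by `n ∈ ℤ`, closed under isomorphism. -/
def shf (X : Set C) (n : ℤ) : Set C := {Z | ∃ A ∈ X, Nonempty (Z ≅ A⟦n⟧)}

/-- `star X Y` consists of the objects `Z` fitting in a distinguished triangle
`A ⟶ Z ⟶ B ⟶ A⟦1⟧` with `A ∈ X` and `B ∈ Y`. -/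
def star (X Y : Set C) : Set C :=
  {Z | ∃ (A B : C) (f : A ⟶ Z) (g : Z ⟶ B) (h : B ⟶ A⟦(1:ℤ)⟧),
    A ∈ X ∧ B ∈ Y ∧ Triangle.mk f g h ∈ distTriang C}

/-- `X^⊥ = {Z : Hom(X', Z) = 0 for all X' ∈ X}`. -/
def rightOrth (X : Set C) : Set C := {Z | ∀ A ∈ X, ∀ f : A ⟶ Z, f = 0}

/-- `⊥X = {Z : Hom(Z, X') = 0 for all X' ∈ X}`. -/
def leftOrth (X : Set C) : Set C := {Z | ∀ B ∈ X, ∀ f : Z ⟶ B, f = 0}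

/-- A class of objects is closed under isomorphisms. -/
def isoClosed (X : Set C) : Prop := ∀ ⦃A B : C⦄, A ∈ X → (A ≅ B) → B ∈ X

/-- A class of objects is closed under direct summands. -/
def summandClosed (X : Set C) : Prop :=
  ∀ ⦃W Z : C⦄, W ∈ X → (∃ (i : Z ⟶ W) (r : W ⟶ Z), i ≫ r = 𝟙 Z) → Z ∈ X

/-- `W` is a direct sum of `A` and `B` (i.e. carries a binary biproduct structure). -/
def isDirectSum (W A B : C) : Prop :=
  ∃ (iA : A ⟶ W) (iB : B ⟶ W) (pA : W ⟶ A) (pB : W ⟶ B),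
    iA ≫ pA = 𝟙 A ∧ iB ≫ pB = 𝟙 B ∧ iA ≫ pB = 0 ∧ iB ≫ pA = 0 ∧
      pA ≫ iA + pB ≫ iB = 𝟙 W

/-- An additive class of objects: it contains a zero object and is closed under
finite (binary) direct sums. -/
def addClosed (X : Set C) : Prop :=
  (∃ Z ∈ X, IsZero Z) ∧ ∀ ⦃A B W : C⦄, A ∈ X → B ∈ X → isDirectSum W A B → W ∈ X

/-- `X = add X` : `X` is closed under isomorphisms, finite direct sums and direct summands. -/
def isAdd (X : Set C) : Prop := isoClosed X ∧ addClosed X ∧ summandClosed X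

/-- A class is suspended if it is closed under `[1]` and under extensions. -/
def suspended (X : Set C) : Prop := shf X 1 ⊆ X ∧ star X X ⊆ X

/-- A class is cosuspended if it is closed under `[-1]` and under extensions. -/
def cosuspended (X : Set C) : Prop := shf X (-1) ⊆ X ∧ star X X ⊆ X

/-- `ε^∧_n(X)`: defined inductively, `ε^∧_0(X) = X` and `Z ∈ ε^∧_{n+1}(X)` iff there is a
distinguished triangle `Z⟦-1⟧ ⟶ W ⟶ A ⟶ Z` (equivalently `W ⟶ A ⟶ Z ⟶ W⟦1⟧`) with
`W ∈ ε^∧_n(X)` and `A ∈ X`. -/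
def epsHat (X : Set C) : ℕ → Set C
  | 0 => X
  | n + 1 =>
    {Z | ∃ (W A : C) (f : W ⟶ A) (g : A ⟶ Z) (h : Z ⟶ W⟦(1:ℤ)⟧),
      W ∈ epsHat X n ∧ A ∈ X ∧ Triangle.mk f g h ∈ distTriang C}

/-- `ε^∨_n(X)`: `ε^∨_0(X) = X` and `Z ∈ ε^∨_{n+1}(X)` iff there is a distinguished
triangle `Z ⟶ A ⟶ K ⟶ Z⟦1⟧` with `A ∈ X` and `K ∈ ε^∨_n(X)`. -/
def epsCheck (X : Set C) : ℕ → Set C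
  | 0 => X
  | n + 1 =>
    {Z | ∃ (A K : C) (f : Z ⟶ A) (g : A ⟶ K) (h : K ⟶ Z⟦(1:ℤ)⟧),
      A ∈ X ∧ K ∈ epsCheck X n ∧ Triangle.mk f g h ∈ distTriang C}

/-- `X^∧ := ∪_{n ≥ 0} ε^∧_n(X)`. -/
def hat (X : Set C) : Set C := ⋃ n : ℕ, epsHat X n

/-- `X^∨ := ∪_{n ≥ 0} ε^∨_n(X)`. -/
def check (X : Set C) : Set C := ⋃ n : ℕ, epsCheck X n

/-- `X~ := (X^∧)^∨`. -/
def tilde (X : Set C) : Set C := check (hat X)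

/-- `resdim_X(M) := min {n : M ∈ ε^∧_n(X)}`, with `min ∅ = ∞`. -/
noncomputable def resdim (X : Set C) (M : C) : ℕ∞ :=
  sInf {n : ℕ∞ | ∃ m : ℕ, n = (m : ℕ∞) ∧ M ∈ epsHat X m}

/-- `coresdim_X(M) := min {n : M ∈ ε^∨_n(X)}`, with `min ∅ = ∞`. -/
noncomputable def coresdim (X : Set C) (M : C) : ℕ∞ :=
  sInf {n : ℕ∞ | ∃ m : ℕ, n = (m : ℕ∞) ∧ M ∈ epsCheck X m}

/-- `id_X(M) := min {n ∈ ℕ : Hom(-, M[i])|_X = 0 for all i > n}`, with `min ∅ = ∞`. -/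
noncomputable def idDim (X : Set C) (M : C) : ℕ∞ :=
  sInf {n : ℕ∞ | ∃ m : ℕ, n = (m : ℕ∞) ∧
    ∀ i : ℤ, (m : ℤ) < i → ∀ A ∈ X, ∀ f : A ⟶ M⟦i⟧, f = 0}

/-- `pd_X(M) := min {n ∈ ℕ : Hom(M[-i], -)|_X = 0 for all i > n}`, with `min ∅ = ∞`. -/
noncomputable def pdDim (X : Set C) (M : C) : ℕ∞ :=
  sInf {n : ℕ∞ | ∃ m : ℕ, n = (m : ℕ∞) ∧
    ∀ i : ℤ, (m : ℤ) < i → ∀ B ∈ X, ∀ f : M⟦(-i : ℤ)⟧ ⟶ B, f = 0}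

/-- `id_X(Y) := sup {id_X(M) : M ∈ Y}`. -/
noncomputable def idDimSet (X Y : Set C) : ℕ∞ := ⨆ M ∈ Y, idDim X M

/-- `pd_X(Y) := sup {pd_X(M) : M ∈ Y}`. -/
noncomputable def pdDimSet (X Y : Set C) : ℕ∞ := ⨆ M ∈ Y, pdDim X M

/-- `ω` is `X`-injective: `id_X(W) = 0` for every `W ∈ ω`. -/
def xInjective (X ω : Set C) : Prop := ∀ W ∈ ω, idDim X W = 0

/-- `ω` is `X`-projective: `pd_X(W) = 0` for every `W ∈ ω`. -/
def xProjective (X ω : Set C) : Prop := ∀ W ∈ ω, pdDim X W = 0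

/-- `ω` is a weak-cogenerator in `X`: `ω ⊆ X ⊆ X[-1] * ω`. -/
def weakCogenerator (ω X : Set C) : Prop := ω ⊆ X ∧ X ⊆ star (shf X (-1)) ω

/-- `ω` is a weak-generator in `X`: `ω ⊆ X ⊆ ω * X[1]`. -/
def weakGenerator (ω X : Set C) : Prop := ω ⊆ X ∧ X ⊆ star ω (shf X 1)

/-- `ω` is silting: `Hom(W, W'[i]) = 0` for all `W, W' ∈ ω` and all `i > 0`. -/
def silting (ω : Set C) : Prop :=
  ∀ W ∈ ω, ∀ W' ∈ ω, ∀ i : ℤ, 0 < i → ∀ f : W ⟶ W'⟦i⟧, f = 0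

/-- A thick subcategory: a (full, additive, isomorphism-closed) triangulated subcategory
closed under direct summands. -/
structure IsThick (S : Set C) : Prop where
  zero : ∃ Z ∈ S, IsZero Z
  iso : isoClosed S
  shift : ∀ n : ℤ, shf S n ⊆ S
  ext : star S S ⊆ S
  summand : summandClosed S

/-- `Δ̄_T(X)`: the smallest thick subcategory containing `X`. -/
def thickClosure (X : Set C) : Set C := ⋂₀ {S : Set C | IsThick S ∧ X ⊆ S}

/-- `U_ω`: the smallest suspended class containing `ω`. -/
def uPlus (ω : Set C) : Set C := ⋂₀ {S : Set C | suspended S ∧ ω ⊆ S}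

/-- `_ωU`: the smallest cosuspended class containing `ω`. -/
def uMinus (ω : Set C) : Set C := ⋂₀ {S : Set C | cosuspended S ∧ ω ⊆ S}

/-- `_ωŪ`: the smallest cosuspended class containing `ω` closed under direct summands. -/
def uMinusBar (ω : Set C) : Set C :=
  ⋂₀ {S : Set C | cosuspended S ∧ summandClosed S ∧ ω ⊆ S}

/-- `(A, B)` is a co-t-structure on the triangulated subcategory `S` of `C`:
`A` and `B` are full additive subcategories of `S` closed under isomorphisms and direct
summands, `A[-1] ⊆ A`, `B[1] ⊆ B`, `Hom(A[-1], B) = 0` and `S = A[-1] * B`. -/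
structure IsCotStructure (S A B : Set C) : Prop where
  subA : A ⊆ S
  subB : B ⊆ S
  isoA : isoClosed A
  isoB : isoClosed B
  addA : addClosed A
  addB : addClosed B
  summandA : summandClosed A
  summandB : summandClosed B
  shiftA : shf A (-1) ⊆ A
  shiftB : shf B 1 ⊆ B
  orth : ∀ A' ∈ shf A (-1), ∀ B' ∈ B, ∀ f : A' ⟶ B', f = 0
  decomp : S = star (shf A (-1)) B

/-- A relative Auslander-Buchweitz context on `C` : `X` is cosuspended and closed under
direct summands, `Y` is suspended, closed under direct summands and `Y ⊆ X^∧`, and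
`ω := X ∩ Y` is an `X`-injective weak-cogenerator in `X`. -/
structure RelativeABContext (X Y : Set C) : Prop where
  cosusp : cosuspended X
  summandX : summandClosed X
  susp : suspended Y
  summandY : summandClosed Y
  sub : Y ⊆ hat X
  inj : xInjective X (X ∩ Y)
  wcog : weakCogenerator (X ∩ Y) X


section helpers

set_option linter.unusedSectionVars false

theorem sAdd (A : C) (a b c : ℤ) (h : a + b = c) : Nonempty (A⟦a⟧⟦b⟧ ≅ A⟦c⟧) :=
  ⟨((shiftFunctorAdd' C a b c h).app A).symm⟩

theorem sZero (A : C) : Nonempty (A⟦(0:ℤ)⟧ ≅ A) := ⟨(shiftFunctorZero C ℤ).app A⟩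

theorem sInv (A : C) (a b : ℤ) (h : a + b = 0) : Nonempty (A⟦a⟧⟦b⟧ ≅ A) := by
  obtain ⟨e⟩ := sAdd A a b 0 h
  obtain ⟨e'⟩ := sZero A
  exact ⟨e ≪≫ e'⟩

/-- vanishing of all morphisms -/
def HV (A B : C) : Prop := ∀ f : A ⟶ B, f = 0

theorem HV.iso {A A' B B' : C} (h : HV A B) (e : A ≅ A') (e' : B ≅ B') : HV A' B' := by
  intro f
  have := h (e.hom ≫ f ≫ e'.inv)
  have h2 : e.inv ≫ (e.hom ≫ f ≫ e'.inv) ≫ e'.hom = f := by simp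
  rw [← h2, this]; simp

theorem HV.shift {A B : C} (h : HV A B) (n : ℤ) : HV (A⟦n⟧) (B⟦n⟧) := by
  intro f
  obtain ⟨g, rfl⟩ := (CategoryTheory.shiftFunctor C n).map_surjective f
  rw [h g]; simp

theorem HV.shift' {A B : C} (m k n l : ℤ) (h : HV (A⟦m⟧) (B⟦k⟧)) (e : m + l = n + k) :
    HV (A⟦n⟧) (B⟦l⟧) := by
  obtain ⟨e1⟩ := sAdd A m (n - m) n (by omega)
  obtain ⟨e2⟩ := sAdd B k (n - m) l (by omega)
  exact (h.shift (n - m)).iso e1 e2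

theorem HV.ofZero {A B : C} (k n l : ℤ) (h : HV A (B⟦k⟧)) (e : l = n + k) :
    HV (A⟦n⟧) (B⟦l⟧) := by
  obtain ⟨e0⟩ := sZero A
  exact HV.shift' 0 k n l (h.iso e0.symm (Iso.refl _)) (by omega)

theorem HV.toZero {A B : C} (k n l : ℤ) (h : HV (A⟦n⟧) (B⟦l⟧)) (e : l = n + k) :
    HV A (B⟦k⟧) := by
  obtain ⟨e0⟩ := sZero A
  exact (HV.shift' n l 0 k h (by omega)).iso e0 (Iso.refl _)

theorem HV.isoR {A B B' : C} (h : HV A B) (e : B ≅ B') : HV A B' := h.iso (Iso.refl _) e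
theorem HV.isoL {A A' B : C} (h : HV A B) (e : A ≅ A') : HV A' B := h.iso e (Iso.refl _)

theorem mem_shf {X : Set C} (hi : isoClosed X) (n : ℤ) (Z : C) : Z ∈ shf X n ↔ Z⟦-n⟧ ∈ X := by
  constructor
  · rintro ⟨A, hA, ⟨e⟩⟩
    obtain ⟨e1⟩ := sInv A n (-n) (by omega)
    exact hi hA (e1.symm ≪≫ ((CategoryTheory.shiftFunctor C (-n)).mapIso e).symm)
  · intro h
    obtain ⟨e1⟩ := sInv Z (-n) n (by omega)
    exact ⟨_, h, ⟨e1.symm⟩⟩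

theorem shf_mem {X : Set C} {A : C} (hA : A ∈ X) (n : ℤ) : A⟦n⟧ ∈ shf X n := ⟨A, hA, ⟨Iso.refl _⟩⟩

theorem star_mem {X : Set C} (h : star X X ⊆ X) {T : Triangle C} (hT : T ∈ distTriang C)
    (h1 : T.obj₁ ∈ X) (h3 : T.obj₃ ∈ X) : T.obj₂ ∈ X :=
  h ⟨_, _, T.mor₁, T.mor₂, T.mor₃, h1, h3, hT⟩

/-- the class of `Z` with `Hom(X, Z[1]) = 0` -/
def RY (X : Set C) : Set C := {Z | ∀ x ∈ X, HV x (Z⟦(1:ℤ)⟧)}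

theorem ry_eq (X : Set C) : shf (rightOrth X) (-1) = RY X := by
  have hi : isoClosed (rightOrth X) := by
    intro A B hA e x hx
    exact HV.isoR (hA x hx) e
  ext Z
  rw [mem_shf hi]
  exact Iff.rfl

theorem negMem {X : Set C} (hX : shf X (-1) ⊆ X) (hi : isoClosed X) {A : C} (hA : A ∈ X)
    (n : ℕ) : A⟦(-n : ℤ)⟧ ∈ X := by
  induction n with
  | zero => obtain ⟨e⟩ := sZero A; exact hi hA (by simpa using e.symm)
  | succ n ih =>
    obtain ⟨e⟩ := sAdd A (-n : ℤ) (-1) (-(n + 1 : ℕ) : ℤ) (by push_cast; omega)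
    exact hi (hX (shf_mem ih (-1))) e

theorem posMem {X : Set C} (hX : shf X 1 ⊆ X) (hi : isoClosed X) {A : C} (hA : A ∈ X)
    (n : ℕ) : A⟦(n : ℤ)⟧ ∈ X := by
  induction n with
  | zero => obtain ⟨e⟩ := sZero A; exact hi hA (by simpa using e.symm)
  | succ n ih =>
    obtain ⟨e⟩ := sAdd A (n : ℤ) 1 ((n + 1 : ℕ) : ℤ) (by push_cast; omega)
    exact hi (hX (shf_mem ih 1)) e

theorem ry_iso (X : Set C) : isoClosed (RY X) := by
  intro A B hA e x hx
  exact HV.isoR (hA x hx) ((CategoryTheory.shiftFunctor C (1:ℤ)).mapIso e)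

theorem ry_summand (X : Set C) : summandClosed (RY X) := by
  rintro W Z hW ⟨i, r, h⟩ x hx f
  have h1 := hW x hx (f ≫ i⟦(1:ℤ)⟧')
  have h2 : f = (f ≫ i⟦(1:ℤ)⟧') ≫ r⟦(1:ℤ)⟧' := by
    rw [Category.assoc, ← Functor.map_comp, h]; simp
  rw [h2, h1]; simp

theorem ry_add (X : Set C) : addClosed (RY X) := by
  obtain ⟨Z, hZ⟩ := HasZeroObject.zero (C := C)
  refine ⟨⟨Z, ?_, hZ⟩, ?_⟩
  · intro x _ f
    exact ((CategoryTheory.shiftFunctor C (1:ℤ)).map_isZero hZ).eq_of_tgt _ _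
  · rintro A B W hA hB ⟨iA, iB, pA, pB, -, -, -, -, h⟩ x hx f
    have h1 := hA x hx (f ≫ pA⟦(1:ℤ)⟧')
    have h2 := hB x hx (f ≫ pB⟦(1:ℤ)⟧')
    have h3 : f = (f ≫ pA⟦(1:ℤ)⟧') ≫ iA⟦(1:ℤ)⟧' + (f ≫ pB⟦(1:ℤ)⟧') ≫ iB⟦(1:ℤ)⟧' := by
      rw [Category.assoc, Category.assoc, ← Functor.map_comp, ← Functor.map_comp,
        ← Preadditive.comp_add, ← Functor.map_add, h]; simp
    rw [h3, h1, h2]; simp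

theorem ry_shift {X : Set C} (hX : shf X (-1) ⊆ X) : shf (RY X) 1 ⊆ RY X := by
  rintro Z ⟨A, hA, ⟨e⟩⟩ x hx
  refine HV.isoR ?_ ((CategoryTheory.shiftFunctor C (1:ℤ)).mapIso e.symm)
  obtain ⟨e2⟩ := sAdd A 1 1 2 (by omega)
  refine HV.isoR ?_ e2.symm
  exact HV.toZero 2 (-1) 1 (hA _ (hX (shf_mem hx (-1)))) (by omega)

theorem hv_mid_right {x : C} {T : Triangle C} (hT : T ∈ distTriang C)
    (h1 : HV x T.obj₁) (h3 : HV x T.obj₃) : HV x T.obj₂ := by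
  intro f
  obtain ⟨g, hg⟩ := T.coyoneda_exact₂ hT f (h3 _)
  rw [hg, h1 g]; simp

theorem hv_mid_left {x : C} {T : Triangle C} (hT : T ∈ distTriang C)
    (h1 : HV T.obj₁ x) (h3 : HV T.obj₃ x) : HV T.obj₂ x := by
  intro f
  obtain ⟨g, hg⟩ := T.yoneda_exact₂ hT f (h1 _)
  rw [hg, h3 g]; simp

theorem ry_star (X : Set C) : star (RY X) (RY X) ⊆ RY X := by
  rintro Z ⟨A, B, f, g, h, hA, hB, hT⟩ x hx
  exact hv_mid_right (Triangle.shift_distinguished _ hT 1) (hA x hx) (hB x hx)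

theorem isAdd_inter {X Y : Set C} (hX : isAdd X) (hY : isAdd Y) : isAdd (X ∩ Y) := by
  obtain ⟨i1, ⟨⟨Z1, z1, hz1⟩, a1⟩, s1⟩ := hX
  obtain ⟨i2, ⟨⟨Z2, z2, hz2⟩, a2⟩, s2⟩ := hY
  refine ⟨fun A B h e => ⟨i1 h.1 e, i2 h.2 e⟩, ⟨⟨Z1, ⟨z1, i2 z2 (hz2.iso hz1)⟩, hz1⟩, ?_⟩, ?_⟩
  · intro A B W hA hB h
    exact ⟨a1 hA.1 hB.1 h, a2 hA.2 hB.2 h⟩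
  · intro W Z h hr
    exact ⟨s1 h.1 hr, s2 h.2 hr⟩

theorem idDim_zero {X : Set C} (hX : shf X (-1) ⊆ X) (hi : isoClosed X) (W : C) :
    idDim X W = 0 ↔ W ∈ RY X := by
  unfold idDim
  constructor
  · intro h
    set S := {n : ℕ∞ | ∃ m : ℕ, n = (m : ℕ∞) ∧
      ∀ i : ℤ, (m : ℤ) < i → ∀ A ∈ X, ∀ f : A ⟶ W⟦i⟧, f = 0} with hS
    have hne : S.Nonempty := by
      by_contra hne
      rw [Set.not_nonempty_iff_eq_empty] at hne
      rw [hne] at h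
      simp at h
    have h0 := csInf_mem hne
    rw [h] at h0
    obtain ⟨m, hm, hm'⟩ := h0
    have : m = 0 := by exact_mod_cast hm.symm
    subst this
    intro x hx
    exact hm' 1 (by simp) x hx
  · intro h
    apply le_antisymm _ zero_le
    apply sInf_le
    refine ⟨0, rfl, ?_⟩
    intro i hi' A hA
    have hA' : A⟦(1 - i : ℤ)⟧ ∈ X := by
      obtain ⟨k, hk⟩ := Int.eq_ofNat_of_zero_le (a := i - 1) (by push_cast at hi'; omega)
      have := negMem hX hi hA k
      rwa [show (1 - i : ℤ) = -k by omega]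
    exact HV.toZero i (1 - i) 1 (h _ hA') (by omega)

theorem thick_union {X : Set C} (hi : isoClosed X) (hs : summandClosed X) (hst : star X X ⊆ X)
    (hz : ∃ Z ∈ X, IsZero Z)
    (hd : ∀ A B : C, ∀ n m : ℤ, A⟦n⟧ ∈ X → B⟦m⟧ ∈ X → ∃ k : ℤ, A⟦k⟧ ∈ X ∧ B⟦k⟧ ∈ X) :
    IsThick {Z : C | ∃ n : ℤ, Z⟦n⟧ ∈ X} := by
  refine ⟨?_, ?_, ?_, ?_, ?_⟩
  · obtain ⟨Z, h, h'⟩ := hz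
    obtain ⟨e⟩ := sZero Z
    exact ⟨Z, ⟨0, hi h e.symm⟩, h'⟩
  · rintro A B ⟨n, h⟩ e
    exact ⟨n, hi h ((CategoryTheory.shiftFunctor C n).mapIso e)⟩
  · rintro n Z ⟨A, ⟨m, h⟩, ⟨e⟩⟩
    obtain ⟨e1⟩ := sAdd A n (m - n) m (by omega)
    exact ⟨m - n, hi h (e1.symm ≪≫ ((CategoryTheory.shiftFunctor C (m - n)).mapIso e).symm)⟩
  · rintro Z ⟨A, B, f, g, h, ⟨n, hA⟩, ⟨m, hB⟩, hT⟩
    obtain ⟨k, hk1, hk2⟩ := hd A B n m hA hB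
    exact ⟨k, star_mem hst (Triangle.shift_distinguished _ hT k) hk1 hk2⟩
  · rintro W Z ⟨n, h⟩ ⟨i, r, hr⟩
    refine ⟨n, hs h ⟨i⟦n⟧', r⟦n⟧', ?_⟩⟩
    rw [← Functor.map_comp, hr, CategoryTheory.Functor.map_id]

theorem mono_neg {X : Set C} (hX : shf X (-1) ⊆ X) (hi : isoClosed X) {A : C} {n m : ℤ}
    (h : A⟦n⟧ ∈ X) (hm : m ≤ n) : A⟦m⟧ ∈ X := by
  obtain ⟨k, hk⟩ := Int.eq_ofNat_of_zero_le (a := n - m) (by omega)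
  obtain ⟨e⟩ := sAdd A n (-k : ℤ) m (by omega)
  exact hi (negMem hX hi h k) e

theorem mono_pos {X : Set C} (hX : shf X 1 ⊆ X) (hi : isoClosed X) {A : C} {n m : ℤ}
    (h : A⟦n⟧ ∈ X) (hm : n ≤ m) : A⟦m⟧ ∈ X := by
  obtain ⟨k, hk⟩ := Int.eq_ofNat_of_zero_le (a := m - n) (by omega)
  obtain ⟨e⟩ := sAdd A n (k : ℤ) m (by omega)
  exact hi (posMem hX hi h k) e

theorem thick_union_neg {X : Set C} (hi : isoClosed X) (hs : summandClosed X)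
    (hst : star X X ⊆ X) (hz : ∃ Z ∈ X, IsZero Z) (hX : shf X (-1) ⊆ X) :
    IsThick {Z : C | ∃ n : ℤ, Z⟦n⟧ ∈ X} :=
  thick_union hi hs hst hz fun A B n m hA hB =>
    ⟨min n m, mono_neg hX hi hA (min_le_left _ _), mono_neg hX hi hB (min_le_right _ _)⟩

theorem thick_union_pos {X : Set C} (hi : isoClosed X) (hs : summandClosed X)
    (hst : star X X ⊆ X) (hz : ∃ Z ∈ X, IsZero Z) (hX : shf X 1 ⊆ X) :
    IsThick {Z : C | ∃ n : ℤ, Z⟦n⟧ ∈ X} :=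
  thick_union hi hs hst hz fun A B n m hA hB =>
    ⟨max n m, mono_pos hX hi hA (le_max_left _ _), mono_pos hX hi hB (le_max_right _ _)⟩

theorem union_iff {X : Set C} (hi : isoClosed X) :
    (⋃ n : ℤ, shf X n) = Set.univ ↔ ∀ Z : C, ∃ n : ℤ, Z⟦n⟧ ∈ X := by
  rw [Set.eq_univ_iff_forall]
  refine forall_congr' fun Z => ?_
  rw [Set.mem_iUnion]
  constructor
  · rintro ⟨n, h⟩
    exact ⟨-n, (mem_shf hi n Z).1 h⟩
  · rintro ⟨n, h⟩
    exact ⟨-n, (mem_shf hi (-n) Z).2 (by rwa [neg_neg])⟩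

theorem thick_all {ω S : Set C} (h : thickClosure ω = Set.univ) (hS : IsThick S) (hω : ω ⊆ S)
    (Z : C) : Z ∈ S := by
  have : Z ∈ thickClosure ω := by rw [h]; trivial
  exact this S ⟨hS, hω⟩

theorem check_sub {ω S : Set C} (hS : cosuspended S) (hω : ω ⊆ S) : check ω ⊆ S := by
  intro Z hZ
  obtain ⟨n, hn⟩ := Set.mem_iUnion.1 hZ
  induction n generalizing Z with
  | zero => exact hω hn
  | succ n ih =>
    obtain ⟨A, K, f, g, h, hA, hK, hT⟩ := hn
    have hK' : K ∈ S := ih (Set.mem_iUnion.2 ⟨n, hK⟩) hK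
    exact star_mem hS.2 (inv_rot_of_distTriang _ hT) (hS.1 (shf_mem hK' (-1))) (hω hA)

/-- Resolution lemma. -/
theorem sub_check {X' Y ω : Set C} (hYi : isoClosed Y) (hYs : suspended Y)
    (hω : ω ⊆ Y) (hXY : X' ∩ Y ⊆ ω) (hbd : ∀ Z : C, ∃ n : ℤ, Z⟦n⟧ ∈ Y)
    (hap : ∀ Z ∈ X', ∃ T ∈ distTriang C, T.obj₁ = Z ∧ T.obj₂ ∈ ω ∧ T.obj₃ ∈ X') :
    X' ⊆ check ω := by
  have key : ∀ n : ℕ, ∀ Z ∈ X', Z⟦(n:ℤ)⟧ ∈ Y → Z ∈ epsCheck ω n := by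
    intro n
    induction n with
    | zero =>
      intro Z hZ hY
      obtain ⟨e⟩ := sZero Z
      exact hXY ⟨hZ, hYi (by simpa using hY) e⟩
    | succ n ih =>
      intro Z hZ hY
      obtain ⟨T, hT, rfl, h2, h3⟩ := hap Z hZ
      refine ⟨_, _, T.mor₁, T.mor₂, T.mor₃, h2, ih _ h3 ?_, hT⟩
      have := Triangle.shift_distinguished _ (rot_of_distTriang _ hT) (n:ℤ)
      refine star_mem hYs.2 this (posMem hYs.1 hYi (hω h2) n) ?_
      obtain ⟨e⟩ := sAdd T.obj₁ 1 (n:ℤ) ((n+1:ℕ):ℤ) (by push_cast; omega)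
      exact hYi hY e.symm
  intro Z hZ
  obtain ⟨n, hn⟩ := hbd Z
  refine Set.mem_iUnion.2 ⟨n.toNat, key _ Z hZ (mono_pos hYs.1 hYi hn (by omega))⟩

section mk

variable {A B D : C} {f : A ⟶ B} {g : B ⟶ D} {h : D ⟶ A⟦(1:ℤ)⟧}

theorem mk_coyoneda_exact₂ (hT : Triangle.mk f g h ∈ distTriang C) {x : C} (t : x ⟶ B)
    (ht : t ≫ g = 0) : ∃ s : x ⟶ A, t = s ≫ f := Triangle.coyoneda_exact₂ _ hT t ht

theorem mk_coyoneda_exact₃ (hT : Triangle.mk f g h ∈ distTriang C) {x : C} (t : x ⟶ D)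
    (ht : t ≫ h = 0) : ∃ s : x ⟶ B, t = s ≫ g := Triangle.coyoneda_exact₃ _ hT t ht

theorem mk_yoneda_exact₂ (hT : Triangle.mk f g h ∈ distTriang C) {x : C} (t : B ⟶ x)
    (ht : f ≫ t = 0) : ∃ s : D ⟶ x, t = g ≫ s := Triangle.yoneda_exact₂ _ hT t ht

theorem mk_yoneda_exact₃ (hT : Triangle.mk f g h ∈ distTriang C) {x : C} (t : D ⟶ x)
    (ht : g ≫ t = 0) : ∃ s : A⟦(1:ℤ)⟧ ⟶ x, t = h ≫ s := Triangle.yoneda_exact₃ _ hT t ht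

theorem mk_yoneda_exact₁ (hT : Triangle.mk f g h ∈ distTriang C) {x : C} (t : A ⟶ x)
    (ht : h ≫ t⟦(1:ℤ)⟧' = 0) : ∃ s : B ⟶ x, t = f ≫ s := by
  have h3 : Triangle.mk h (-f⟦(1:ℤ)⟧') (-g⟦(1:ℤ)⟧') ∈ distTriang C :=
    rot_of_distTriang _ (rot_of_distTriang _ hT)
  obtain ⟨k, hk⟩ := mk_yoneda_exact₂ h3 (t⟦(1:ℤ)⟧') ht
  obtain ⟨k', rfl⟩ := (CategoryTheory.shiftFunctor C (1:ℤ)).map_surjective k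
  refine ⟨-k', ?_⟩
  apply (CategoryTheory.shiftFunctor C (1:ℤ)).map_injective
  rw [hk]
  simp

theorem mk_complete {A' B' D' : C} {f' : A' ⟶ B'} {g' : B' ⟶ D'} {h' : D' ⟶ A'⟦(1:ℤ)⟧}
    (hT : Triangle.mk f g h ∈ distTriang C) (hT' : Triangle.mk f' g' h' ∈ distTriang C)
    (a : A ⟶ A') (c : D ⟶ D') (comm : h ≫ a⟦(1:ℤ)⟧' = c ≫ h') :
    ∃ b : B ⟶ B', f ≫ b = a ≫ f' ∧ g ≫ c = b ≫ g' :=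
  complete_distinguished_triangle_morphism₂ _ _ hT hT' a c comm

end mk

/-- the class of `Z` with `Hom(Z, Y[1]) = 0` -/
def LX (Y : Set C) : Set C := {Z | ∀ y ∈ Y, HV Z (y⟦(1:ℤ)⟧)}

/-- objects of `Y` with an `ω`-precover -/
def EE (X' Y ω : Set C) : Set C :=
  {B | B ∈ Y ∧ ∃ W ∈ ω, ∃ w : W ⟶ B, ∀ x ∈ X', ∀ g : x ⟶ B, ∃ g' : x ⟶ W, g = g' ≫ w}

/-- objects with a good left approximation -/
def DD (E Y : Set C) : Set C :=
  {T | ∃ B ∈ E, ∃ f : T ⟶ B, (∀ y ∈ Y, ∀ t : T ⟶ y, ∃ s : B ⟶ y, f ≫ s = t) ∧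
    (∀ y ∈ Y, ∀ g : B ⟶ y⟦(1:ℤ)⟧, f ≫ g = 0 → g = 0)}

theorem ee_star {Y ω : Set C} (hY : star Y Y ⊆ Y) (ha : isAdd ω) (hω : ω ⊆ LX Y) :
    star (EE (LX Y) Y ω) (EE (LX Y) Y ω) ⊆ EE (LX Y) Y ω := by
  rintro B ⟨B1, B2, p, q, d, ⟨h1, W1, hW1, w1, hw1⟩, ⟨h2, W2, hW2, w2, hw2⟩, hT⟩
  refine ⟨hY ⟨_, _, _, _, _, h1, h2, hT⟩, ?_⟩
  obtain ⟨l, hl⟩ := mk_coyoneda_exact₃ hT w2 (hω hW2 _ h1 _)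
  have : HasBinaryBiproducts C := HasBinaryBiproducts.of_hasBinaryProducts
  refine ⟨W1 ⊞ W2, ha.2.1.2 hW1 hW2
    ⟨biprod.inl, biprod.inr, biprod.fst, biprod.snd, by simp, by simp, by simp, by simp,
      biprod.total⟩, biprod.desc (w1 ≫ p) l, ?_⟩
  intro x hx g
  obtain ⟨g2, hg2⟩ := hw2 x hx (g ≫ q)
  have h0 : (g - g2 ≫ l) ≫ q = 0 := by
    rw [Preadditive.sub_comp, hg2, Category.assoc, ← hl, sub_self]
  obtain ⟨g1, hg1⟩ := mk_coyoneda_exact₂ hT (g - g2 ≫ l) h0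
  obtain ⟨g3, hg3⟩ := hw1 x hx g1
  refine ⟨biprod.lift g3 g2, ?_⟩
  rw [biprod.lift_desc, ← Category.assoc, ← hg3, ← hg1]
  simp

theorem dd_iso (E Y : Set C) : isoClosed (DD E Y) := by
  rintro A A' ⟨B, hB, f, h1, h2⟩ e
  refine ⟨B, hB, e.inv ≫ f, ?_, ?_⟩
  · intro y hy t
    obtain ⟨s, hs⟩ := h1 y hy (e.hom ≫ t)
    exact ⟨s, by rw [Category.assoc, hs]; simp⟩
  · intro y hy g hg
    apply h2 y hy g
    rw [← cancel_epi e.inv]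
    simpa using hg

theorem dd_star {E Y : Set C} (hE : star E E ⊆ E) (hEY : E ⊆ Y) (hY1 : shf Y 1 ⊆ Y) :
    star (DD E Y) (DD E Y) ⊆ DD E Y := by
  rintro T ⟨T1, T2, a, b, c, ⟨B1, hB1, f1, e1, m1⟩, ⟨B2, hB2, f2, e2, m2⟩, hT⟩
  obtain ⟨d, hd⟩ := e2 (B1⟦(1:ℤ)⟧) (hY1 (shf_mem (hEY hB1) 1)) (c ≫ f1⟦(1:ℤ)⟧')
  obtain ⟨B, p, q, hB⟩ := distinguished_cocone_triangle₂ d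
  obtain ⟨f, hf1, hf2⟩ := mk_complete hT hB f1 f2 hd.symm
  have hqd : q ≫ d = 0 := comp_distTriang_mor_zero₂₃ _ hB
  have hca : c ≫ a⟦(1:ℤ)⟧' = 0 := comp_distTriang_mor_zero₃₁ _ hT
  refine ⟨B, hE ⟨_, _, _, _, _, hB1, hB2, hB⟩, f, ?_, ?_⟩
  · intro y hy t
    obtain ⟨s1, hs1⟩ := e1 y hy (a ≫ t)
    have hz : d ≫ s1⟦(1:ℤ)⟧' = 0 := by
      apply m2 y hy
      rw [← Category.assoc, hd, Category.assoc, ← Functor.map_comp, hs1, Functor.map_comp,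
        ← Category.assoc, hca, zero_comp]
    have hs : ∃ s : B ⟶ y, s1 = p ≫ s := by
      exact mk_yoneda_exact₁ hB s1 hz
    obtain ⟨s, hs⟩ := hs
    have h0 : a ≫ (t - f ≫ s) = 0 := by
      rw [Preadditive.comp_sub, ← Category.assoc, hf1, Category.assoc, ← hs, hs1, sub_self]
    obtain ⟨u, hu⟩ := mk_yoneda_exact₂ hT (t - f ≫ s) h0
    obtain ⟨v, hv⟩ := e2 y hy u
    refine ⟨s + q ≫ v, ?_⟩
    rw [Preadditive.comp_add, ← Category.assoc, ← hf2, Category.assoc, hv, ← hu]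
    simp
  · intro y hy g hg
    have h1 : p ≫ g = 0 := by
      apply m1 y hy
      rw [← Category.assoc, ← hf1, Category.assoc, hg, comp_zero]
    obtain ⟨h, hh⟩ := mk_yoneda_exact₂ hB g h1
    have h2 : b ≫ f2 ≫ h = 0 := by
      rw [← Category.assoc, hf2, Category.assoc, ← hh, hg]
    obtain ⟨k, hk⟩ := mk_yoneda_exact₃ hT (f2 ≫ h) h2
    obtain ⟨k', rfl⟩ := (CategoryTheory.shiftFunctor C (1:ℤ)).map_surjective k
    obtain ⟨l, rfl⟩ := e1 y hy k'
    have h3 : h - d ≫ l⟦(1:ℤ)⟧' = 0 := by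
      apply m2 y hy
      rw [Preadditive.comp_sub, hk, ← Category.assoc, hd, Functor.map_comp, Category.assoc,
        sub_self]
    rw [hh, sub_eq_zero.1 h3, ← Category.assoc, hqd, zero_comp]

theorem dd_retract {E Y : Set C} (hE : star E E ⊆ E) (hEY : E ⊆ Y) (hY1 : shf Y 1 ⊆ Y)
    (hz : ∃ Z ∈ E, IsZero Z) (n : ℕ) : ∀ (P M : C) (i : P ⟶ M) (r : M ⟶ P), i ≫ r = 𝟙 P →
      (∀ m : ℤ, M⟦m⟧ ∈ DD E Y) → (∀ y ∈ Y, HV M (y⟦(n:ℤ)⟧)) → P ∈ DD E Y := by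
  induction n with
  | zero =>
    intro P M i r hir _ hM
    obtain ⟨Z, hZ, hZ0⟩ := hz
    refine ⟨Z, hZ, 0, ?_, fun y hy g _ => hZ0.eq_of_src _ _⟩
    intro y hy t
    obtain ⟨e⟩ := sZero y
    have : HV M y := HV.isoR (hM y hy) (by simpa using e)
    refine ⟨0, ?_⟩
    have h1 : t = i ≫ r ≫ t := by rw [← Category.assoc, hir, Category.id_comp]
    rw [h1, this (r ≫ t)]; simp
  | succ n ih =>
    intro P M i r hir hMD hM
    obtain ⟨Q, g, h, hT⟩ := distinguished_cocone_triangle i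
    have : Mono i := by
      have : IsSplitMono i := ⟨⟨r, hir⟩⟩
      infer_instance
    have hh : h = 0 := Triangle.mor₃_eq_zero_of_mono₁ _ hT (by assumption)
    obtain ⟨j, hj⟩ := mk_coyoneda_exact₃ hT (𝟙 Q) (by subst hh; exact comp_zero)
    have hQ : Q⟦(-1:ℤ)⟧ ∈ DD E Y := by
      refine ih (Q⟦(-1:ℤ)⟧) (M⟦(-1:ℤ)⟧) (j⟦(-1:ℤ)⟧') (g⟦(-1:ℤ)⟧') ?_ ?_ ?_
      · rw [← Functor.map_comp, ← hj, CategoryTheory.Functor.map_id]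
      · intro m
        obtain ⟨e⟩ := sAdd M (-1) m (-1 + m) rfl
        exact dd_iso _ _ (hMD _) e.symm
      · intro y hy
        exact HV.ofZero _ (-1) _ (hM y hy) (by push_cast; omega)
    obtain ⟨e⟩ := sZero M
    exact star_mem (dd_star hE hEY hY1) (inv_rot_of_distTriang _ hT) hQ (dd_iso _ _ (hMD 0) e)

theorem core {X ω : Set C} (hX : cosuspended X) (hadd : isAdd X) (hω : isAdd ω) (hωX : ω ⊆ X)
    (hωY : ω ⊆ RY X) (hth : thickClosure ω = Set.univ) :
    IsCotStructure Set.univ X (RY X) ∧ (⋃ n : ℤ, shf X n) = Set.univ ∧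
      (⋃ n : ℤ, shf (RY X) n) = Set.univ := by
  set Y := RY X with hYdef
  have hY1 : shf Y 1 ⊆ Y := ry_shift hX.1
  have hYst : star Y Y ⊆ Y := ry_star X
  have hYi : isoClosed Y := ry_iso X
  have hXi := hadd.1
  have hbX : ∀ Z : C, ∃ n : ℤ, Z⟦n⟧ ∈ X :=
    thick_all hth (thick_union_neg hadd.1 hadd.2.2 hX.2 hadd.2.1.1 hX.1) (fun W hW => by
      obtain ⟨e⟩ := sZero W
      exact ⟨0, hXi (hωX hW) e.symm⟩)
  have hbY : ∀ Z : C, ∃ n : ℤ, Z⟦n⟧ ∈ Y :=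
    thick_all hth (thick_union_pos hYi (ry_summand X) hYst (ry_add X).1 hY1) (fun W hW => by
      obtain ⟨e⟩ := sZero W
      exact ⟨0, hYi (hωY hW) e.symm⟩)
  have hXX' : X ⊆ LX Y := fun x hx y hy => hy x hx
  set E := EE (LX Y) Y ω with hEdef
  have hE : star E E ⊆ E := ee_star hYst hω (hωX.trans hXX')
  have hEY : E ⊆ Y := fun B hB => hB.1
  obtain ⟨Z0, hZ0, hZ0'⟩ := hω.2.1.1
  have hωE : ω ⊆ E := fun W hW => ⟨hωY hW, W, hW, 𝟙 W, fun x _ g => ⟨g, by simp⟩⟩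
  have hYE : ∀ y ∈ Y, ∀ B : C, (y⟦(1:ℤ)⟧ ≅ B) → B ∈ E := by
    intro y hy B e
    refine ⟨hYi (hY1 (shf_mem hy 1)) e, Z0, hZ0, 0, ?_⟩
    intro x hx g
    exact ⟨0, by rw [HV.isoR (hx y hy) e g]; simp⟩
  have hED : E ⊆ DD E Y := fun B hB =>
    ⟨B, hB, 𝟙 B, fun y _ t => ⟨t, by simp⟩, fun y _ g hg => by simpa using hg⟩
  have hdd := dd_star hE hEY hY1
  have hth' : IsThick {T : C | ∀ n : ℤ, T⟦n⟧ ∈ DD E Y} := by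
    refine ⟨⟨Z0, ?_, hZ0'⟩, ?_, ?_, ?_, ?_⟩
    · intro n
      exact dd_iso _ _ (hED (hωE hZ0))
        (hZ0'.iso ((CategoryTheory.shiftFunctor C n).map_isZero hZ0'))
    · intro A B hA e n
      exact dd_iso _ _ (hA n) ((CategoryTheory.shiftFunctor C n).mapIso e)
    · rintro n Z ⟨A, hA, ⟨e⟩⟩ m
      obtain ⟨e1⟩ := sAdd A n m (n + m) rfl
      exact dd_iso _ _ (hA (n + m))
        (e1.symm ≪≫ ((CategoryTheory.shiftFunctor C m).mapIso e).symm)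
    · rintro Z ⟨A, B, f, g, h, hA, hB, hT⟩ n
      exact star_mem hdd (Triangle.shift_distinguished _ hT n) (hA n) (hB n)
    · rintro M P hM ⟨i, r, hir⟩ n
      obtain ⟨k, hk⟩ := hbX (M⟦n⟧)
      have hk' := mono_neg hX.1 hXi hk (show -((-k).toNat : ℤ) ≤ k by omega)
      refine dd_retract hE hEY hY1 ⟨Z0, hωE hZ0, hZ0'⟩ ((-k).toNat + 1) (P⟦n⟧) (M⟦n⟧)
        (i⟦n⟧') (r⟦n⟧') ?_ ?_ ?_
      · rw [← Functor.map_comp, hir, CategoryTheory.Functor.map_id]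
      · intro m
        obtain ⟨e1⟩ := sAdd M n m (n + m) rfl
        exact dd_iso _ _ (hM (n + m)) e1.symm
      · intro y hy
        exact HV.toZero _ _ 1 (hy _ hk') (by push_cast; omega)
  have hall : ∀ Z : C, Z ∈ DD E Y := by
    intro Z
    have := thick_all hth hth' (fun W hW n => by
      rcases lt_trichotomy n 0 with hn | hn | hn
      · refine ⟨Z0, hωE hZ0, 0, ?_, fun y hy g _ => hZ0'.eq_of_src _ _⟩
        intro y hy t
        have h1 : W⟦n + 1⟧ ∈ X := by
          obtain ⟨e⟩ := sZero W
          exact mono_neg hX.1 hXi (hXi (hωX hW) e.symm) (by omega)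
        have h2 : HV (W⟦n⟧) (y⟦(0:ℤ)⟧) := HV.shift' _ _ _ _ (hy _ h1) (by omega)
        obtain ⟨e⟩ := sZero y
        exact ⟨0, by rw [HV.isoR h2 e t]; simp⟩
      · subst hn
        obtain ⟨e⟩ := sZero W
        exact dd_iso _ _ (hED (hωE hW)) e.symm
      · apply hED
        have h1 : W⟦n - 1⟧ ∈ Y := by
          obtain ⟨e⟩ := sZero W
          exact mono_pos hY1 hYi (hYi (hωY hW) e.symm) (by omega)
        obtain ⟨e⟩ := sAdd W (n - 1) 1 n (by omega)
        exact hYE _ h1 _ e) Z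
    obtain ⟨e⟩ := sZero Z
    exact dd_iso _ _ (this 0) e
  -- approximation triangles
  have htri : ∀ Z : C, ∃ (B A : C) (f : Z ⟶ B) (g : B ⟶ A) (h : A ⟶ Z⟦(1:ℤ)⟧),
      Triangle.mk f g h ∈ distTriang C ∧ B ∈ E ∧ A ∈ LX Y ∧
        (∀ y ∈ Y, ∀ t : Z ⟶ y, ∃ s : B ⟶ y, f ≫ s = t) := by
    intro Z
    obtain ⟨B, hB, f, he, hm⟩ := hall Z
    obtain ⟨A, g, h, hT⟩ := distinguished_cocone_triangle f
    refine ⟨B, A, f, g, h, hT, hB, ?_, he⟩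
    intro y hy k
    have hfg : f ≫ g = 0 := comp_distTriang_mor_zero₁₂ _ hT
    have hhf : h ≫ f⟦(1:ℤ)⟧' = 0 := comp_distTriang_mor_zero₃₁ _ hT
    have h1 : g ≫ k = 0 := by
      apply hm y hy
      rw [← Category.assoc, hfg, zero_comp]
    obtain ⟨l, hl⟩ := mk_yoneda_exact₃ hT k h1
    obtain ⟨l', rfl⟩ := (CategoryTheory.shiftFunctor C (1:ℤ)).map_surjective l
    obtain ⟨s, rfl⟩ := he y hy l'
    rw [hl, Functor.map_comp, ← Category.assoc, hhf, zero_comp]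
  have hEω : ∀ B ∈ E, B ∈ LX Y → B ∈ ω := by
    rintro B ⟨-, W, hW, w, hw⟩ hB
    obtain ⟨g, hg⟩ := hw B hB (𝟙 B)
    exact hω.2.2 hW ⟨g, w, hg.symm⟩
  have hap : ∀ Z ∈ LX Y, ∃ (B A : C) (f : Z ⟶ B) (g : B ⟶ A) (h : A ⟶ Z⟦(1:ℤ)⟧),
      Triangle.mk f g h ∈ distTriang C ∧ B ∈ ω ∧ A ∈ LX Y ∧
        (∀ y ∈ Y, ∀ t : Z ⟶ y, ∃ s : B ⟶ y, f ≫ s = t) := by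
    intro Z hZ
    obtain ⟨B, A, f, g, h, hT, hB, hA, he⟩ := htri Z
    refine ⟨B, A, f, g, h, hT, hEω B hB ?_, hA, he⟩
    intro y hy
    exact hv_mid_left hT (hZ y hy) (hA y hy)
  have hLXY : LX Y ∩ Y ⊆ ω := by
    rintro Z ⟨h1, h2⟩
    obtain ⟨B, A, f, g, h, hT, hB, hA, he⟩ := hap Z h1
    obtain ⟨s, hs⟩ := he Z h2 (𝟙 Z)
    exact hω.2.2 hB ⟨f, s, hs⟩
  have hLX : LX Y ⊆ X := by
    refine (sub_check hYi ⟨hY1, hYst⟩ hωY hLXY hbY ?_).trans (check_sub hX hωX)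
    intro Z hZ
    obtain ⟨B, A, f, g, h, hT, hB, hA, he⟩ := hap Z hZ
    exact ⟨_, hT, rfl, hB, hA⟩
  refine ⟨⟨Set.subset_univ _, Set.subset_univ _, hXi, hYi, hadd.2.1, ry_add X, hadd.2.2,
    ry_summand X, hX.1, hY1, ?_, ?_⟩, (union_iff hXi).2 hbX, (union_iff hYi).2 hbY⟩
  · rintro A' ⟨A, hA, ⟨e⟩⟩ y hy
    have h1 : HV (A⟦(-1:ℤ)⟧) (y⟦(0:ℤ)⟧) := HV.ofZero 1 _ _ (hy A hA) (by omega)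
    obtain ⟨e'⟩ := sZero y
    exact h1.iso e.symm e'
  · symm
    rw [Set.eq_univ_iff_forall]
    intro Z
    obtain ⟨B, A, f, g, h, hT, hB, hA, he⟩ := htri Z
    exact ⟨_, _, _, _, _, shf_mem (hLX hA) (-1), hEY hB, inv_rot_of_distTriang _ hT⟩

theorem cot_y {X Y : Set C} (h : IsCotStructure Set.univ X Y) : Y = RY X := by
  apply Set.Subset.antisymm
  · intro y hy x hx
    have h1 : HV (x⟦(-1:ℤ)⟧) y := h.orth _ (shf_mem hx (-1)) y hy
    obtain ⟨e⟩ := sZero y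
    exact HV.toZero 1 (-1) 0 (h1.isoR e.symm) (by omega)
  · intro Z hZ
    have hd : Z ∈ star (shf X (-1)) Y := by rw [← h.decomp]; trivial
    obtain ⟨A', B, f, g, k, ⟨A, hA, ⟨e⟩⟩, hB, hT⟩ := hd
    have h1 : HV (A⟦(-1:ℤ)⟧) (Z⟦(0:ℤ)⟧) := HV.ofZero 1 _ _ (hZ A hA) (by omega)
    obtain ⟨e'⟩ := sZero Z
    have hf : f = 0 := h1.iso e.symm e' f
    obtain ⟨s, hs⟩ := mk_yoneda_exact₂ hT (𝟙 Z) (by subst hf; exact zero_comp)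
    exact h.summandB hB ⟨g, s, hs.symm⟩

theorem moreover {X Y : Set C} (hX : cosuspended X) (h : IsCotStructure Set.univ X Y)
    (hbX : ∀ Z : C, ∃ n : ℤ, Z⟦n⟧ ∈ X) (hbY : ∀ Z : C, ∃ n : ℤ, Z⟦n⟧ ∈ Y) :
    X = uMinus (X ∩ Y) ∧ X = check (X ∩ Y) ∧ Y = uPlus (X ∩ Y) ∧
        X ∩ Y = X ∩ shf (rightOrth X) (-1) := by
  have hYs : suspended Y := ⟨h.shiftB, by rw [cot_y h]; exact ry_star X⟩
  have hXi := h.isoA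
  have hYi := h.isoB
  have hdec : ∀ Z : C, ∃ (A B : C) (f : A⟦(-1:ℤ)⟧ ⟶ Z) (g : Z ⟶ B)
      (k : B ⟶ A⟦(-1:ℤ)⟧⟦(1:ℤ)⟧), A ∈ X ∧ B ∈ Y ∧ Triangle.mk f g k ∈ distTriang C := by
    intro Z
    have hd : Z ∈ star (shf X (-1)) Y := by rw [← h.decomp]; trivial
    obtain ⟨A', B, f, g, k, ⟨A, hA, ⟨e⟩⟩, hB, hT⟩ := hd
    refine ⟨A, B, e.inv ≫ f, g, k ≫ e.hom⟦(1:ℤ)⟧', hA, hB, ?_⟩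
    refine isomorphic_distinguished _ hT _ (Triangle.isoMk _ _ e.symm (Iso.refl _) (Iso.refl _)
      ?_ ?_ ?_)
    · exact Category.comp_id (e.inv ≫ f)
    · exact (Category.comp_id g).trans (Category.id_comp g).symm
    · change (k ≫ e.hom⟦(1:ℤ)⟧') ≫ e.inv⟦(1:ℤ)⟧' = 𝟙 B ≫ k
      rw [Category.assoc, ← Functor.map_comp, e.hom_inv_id]
      simp
  have hsc : X ⊆ check (X ∩ Y) := by
    refine sub_check hYi hYs Set.inter_subset_right (fun _ h => h) hbY ?_
    intro Z hZ
    obtain ⟨A, B, f, g, k, hA, hB, hT⟩ := hdec Z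
    have hA' : A⟦(-1:ℤ)⟧⟦(1:ℤ)⟧ ∈ X := by
      obtain ⟨e⟩ := sInv A (-1) 1 (by omega)
      exact hXi hA e.symm
    have hR := rot_of_distTriang _ hT
    exact ⟨_, hR, rfl, ⟨star_mem hX.2 hR hZ hA', hB⟩, hA'⟩
  have hcs := check_sub hX (Set.inter_subset_left : X ∩ Y ⊆ X)
  refine ⟨?_, hsc.antisymm hcs, ?_, by rw [ry_eq, ← cot_y h]⟩
  · apply Set.Subset.antisymm
    · rintro Z hZ S ⟨hS, hS'⟩
      exact check_sub hS hS' (hsc hZ)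
    · intro Z hZ
      exact hZ X ⟨hX, Set.inter_subset_left⟩
  · apply Set.Subset.antisymm
    · rintro Z hZ S ⟨hS, hS'⟩
      have key : ∀ n : ℕ, ∀ Z ∈ Y, Z⟦(-n:ℤ)⟧ ∈ X → Z ∈ S := by
        intro n
        induction n with
        | zero =>
          intro Z hZ hZX
          obtain ⟨e⟩ := sZero Z
          exact hS' ⟨hXi (by simpa using hZX) e, hZ⟩
        | succ n ih =>
          intro Z hZ hZX
          obtain ⟨A, B, f, g, k, hA, hB, hT⟩ := hdec (Z⟦(-1:ℤ)⟧)
          -- A[-1] → Z[-1] → B → A[-1][1]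
          have hR := rot_of_distTriang _ hT
          have hRR := rot_of_distTriang _ hR
          obtain ⟨eA⟩ := sInv A (-1) 1 (by omega)
          obtain ⟨eZ⟩ := sInv Z (-1) 1 (by omega)
          have hAX : A⟦(-1:ℤ)⟧⟦(1:ℤ)⟧ ∈ X := hXi hA eA.symm
          have hAY : A⟦(-1:ℤ)⟧⟦(1:ℤ)⟧ ∈ Y := star_mem hYs.2 hRR hB (hYi hZ eZ.symm)
          have hBS : B ∈ S := by
            apply ih B hB
            refine star_mem hX.2 (Triangle.shift_distinguished _ hR (-n:ℤ)) ?_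
              (negMem hX.1 hXi hAX n)
            obtain ⟨e⟩ := sAdd Z (-1) (-n:ℤ) (-(n+1:ℕ):ℤ) (by push_cast; omega)
            exact hXi hZX e.symm
          have hZS : Z⟦(-1:ℤ)⟧⟦(1:ℤ)⟧ ∈ S :=
            star_mem hS.2 (rot_of_distTriang _ hRR) (hS' ⟨hAX, hAY⟩) (hS.1 (shf_mem hBS 1))
          obtain ⟨Z1, hZ1, hZ1'⟩ := h.addA.1
          obtain ⟨Z2, hZ2, hZ2'⟩ := h.addB.1
          have hzS : Z1 ∈ S := hS' ⟨hZ1, hYi hZ2 (hZ2'.iso hZ1')⟩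
          refine hS.2 ⟨_, _, eZ.hom, 0, 0, hZS, hzS, ?_⟩
          rw [Triangle.distinguished_iff_of_isZero₃ _ hZ1']
          change IsIso eZ.hom
          infer_instance
      obtain ⟨n, hn⟩ := hbX Z
      exact key (-n).toNat Z hZ (mono_neg hX.1 hXi hn (by omega))
    · intro Z hZ
      exact hZ Y ⟨hYs, Set.inter_subset_right⟩

theorem thick_of_bdd {X ω : Set C} (h : X ⊆ check ω) (hbX : ∀ Z : C, ∃ n : ℤ, Z⟦n⟧ ∈ X) :
    thickClosure ω = Set.univ := by
  rw [Set.eq_univ_iff_forall]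
  rintro Z S ⟨hS, hS'⟩
  obtain ⟨n, hn⟩ := hbX Z
  have h1 : Z⟦n⟧ ∈ S := check_sub ⟨hS.shift (-1), hS.ext⟩ hS' (h hn)
  obtain ⟨e⟩ := sInv Z n (-n) (by omega)
  exact hS.iso (hS.shift (-n) (shf_mem h1 (-n))) e

theorem check_inj {ω : Set C} (hs : silting ω) : check ω ⊆ {Z | ∀ W ∈ ω, ∀ i : ℤ, 0 < i →
    HV Z (W⟦i⟧)} := by
  intro Z hZ
  obtain ⟨n, hn⟩ := Set.mem_iUnion.1 hZ
  clear hZ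
  induction n generalizing Z with
  | zero => exact fun W hW i hi => hs Z hn W hW i hi
  | succ n ih =>
    obtain ⟨A, K, f, g, h, hA, hK, hT⟩ := hn
    intro W hW i hi
    exact hv_mid_left (inv_rot_of_distTriang _ hT)
      (HV.ofZero (i + 1) (-1) i (ih hK W hW (i + 1) (by omega)) (by omega)) (hs A hA W hW i hi)

end helpers

/-- Let `X` be a cosuspended subcategory of `T` with `X = add X`.
Then the following are equivalent: (a) there is a bounded co-t-structure `(X, Y)` on `T`;
(b) `Δ̄_T(X ∩ X^⊥[-1]) = T`; (c) there is a class `ω = add ω ⊆ X` which is `X`-injective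
with `Δ̄_T(ω) = T`; (d) there is a silting class `ω = add ω` with `Δ̄_T(ω) = T` and
`ω ⊆ X ⊆ ω^∨`. Moreover, in that case `X = _ωU = ω^∨`, `Y = U_ω` and
`ω = X ∩ Y = X ∩ X^⊥[-1]` (where `ω := X ∩ Y`). -/
theorem stmt12 (X : Set C) (hX : cosuspended X) (hadd : isAdd X) :
    ([∃ Y : Set C, IsCotStructure Set.univ X Y ∧
        (⋃ n : ℤ, shf X n) = Set.univ ∧ (⋃ n : ℤ, shf Y n) = Set.univ,
      thickClosure (X ∩ shf (rightOrth X) (-1)) = Set.univ,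
      ∃ ω : Set C, isAdd ω ∧ ω ⊆ X ∧ xInjective X ω ∧ thickClosure ω = Set.univ,
      ∃ ω : Set C, isAdd ω ∧ silting ω ∧ thickClosure ω = Set.univ ∧
        ω ⊆ X ∧ X ⊆ check ω].TFAE) ∧
    ∀ Y : Set C, IsCotStructure Set.univ X Y →
      (⋃ n : ℤ, shf X n) = Set.univ → (⋃ n : ℤ, shf Y n) = Set.univ →
      X = uMinus (X ∩ Y) ∧ X = check (X ∩ Y) ∧ Y = uPlus (X ∩ Y) ∧
        X ∩ Y = X ∩ shf (rightOrth X) (-1) := by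
  have hXi := hadd.1
  have hmore : ∀ Y : Set C, IsCotStructure Set.univ X Y →
      (⋃ n : ℤ, shf X n) = Set.univ → (⋃ n : ℤ, shf Y n) = Set.univ →
      X = uMinus (X ∩ Y) ∧ X = check (X ∩ Y) ∧ Y = uPlus (X ∩ Y) ∧
        X ∩ Y = X ∩ shf (rightOrth X) (-1) := fun Y h hbX hbY =>
    moreover hX h ((union_iff hXi).1 hbX) ((union_iff h.isoB).1 hbY)
  have hYadd : isAdd (RY X) := ⟨ry_iso X, ry_add X, ry_summand X⟩
  have hsil : ∀ ω : Set C, ω ⊆ X → ω ⊆ RY X → silting ω := by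
    intro ω h1 h2 W hW W' hW' i hi
    obtain ⟨k, hk⟩ := Int.eq_ofNat_of_zero_le (a := i - 1) (by omega)
    have h3 := h2 hW' _ (negMem hX.1 hXi (h1 hW) k)
    exact HV.toZero i _ 1 h3 (by omega)
  refine ⟨?_, hmore⟩
  tfae_have 1 → 2 := by
    rintro ⟨Y, h, hbX, hbY⟩
    obtain ⟨-, h2, -, h4⟩ := hmore Y h hbX hbY
    rw [← h4]
    exact thick_of_bdd h2.subset ((union_iff hXi).1 hbX)
  tfae_have 2 → 3 := by
    intro h
    rw [ry_eq] at h
    exact ⟨_, isAdd_inter hadd hYadd, Set.inter_subset_left,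
      fun W hW => (idDim_zero hX.1 hXi W).2 hW.2, h⟩
  tfae_have 3 → 1 := by
    rintro ⟨ω, h1, h2, h3, h4⟩
    exact ⟨RY X, core hX hadd h1 h2 (fun W hW => (idDim_zero hX.1 hXi W).1 (h3 W hW)) h4⟩
  tfae_have 1 → 4 := by
    rintro ⟨Y, h, hbX, hbY⟩
    obtain ⟨-, h2, -, -⟩ := hmore Y h hbX hbY
    have hY := cot_y h
    refine ⟨X ∩ Y, ?_, hsil _ Set.inter_subset_left (by rw [hY]; exact Set.inter_subset_right),
      thick_of_bdd h2.subset ((union_iff hXi).1 hbX), Set.inter_subset_left, h2.subset⟩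
    rw [hY]
    exact isAdd_inter hadd hYadd
  tfae_have 4 → 3 := by
    rintro ⟨ω, h1, h2, h3, h4, h5⟩
    exact ⟨ω, h1, h4, fun W hW => (idDim_zero hX.1 hXi W).2 fun x hx =>
      check_inj h2 (h5 hx) W hW 1 (by omega), h3⟩
  tfae_finish

end CotPaper
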